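/- Let p be a prime and A a graded Z_(p)-algebra equipped with a map from MU_* (equivalently, from the Lazard ring) classifying a graded formal group law G, such that A is concentrated in nonnegative degrees, degreewise finitely generated free over Z_(p), the sequence (p, v₁, ..., v_n) determined by G is regular, and A/(p, v₁, ..., v_n) ≅ F_p concentrated in degree 0. Then the composite Z_(p)[v₁, ..., v_n] ⊆ BP_* → A is an isomorphism of graded rings. [Algebraic core: a graded ring A, nonnegatively graded, degreewise finite free over Z_(p), with elements v₁,...,v_n of degrees 2(p^i − 1) such that (p, v₁,...,v_n) is regular and the quotient is F_p in degree 0, receives an isomorphism from the polynomial ring Z_(p)[v₁,...,v_n] when A is generated by the v_i.] -/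

import Mathlib

open scoped DirectSum

namespace MvPolynomial

open RingTheory.Sequence

theorem aeval_eq_eval₂_finSuccEquiv {k A : Type*} [CommRing k] [CommRing A] [Algebra k A] {n : ℕ}
    (v : Fin (n + 1) → A) (f : MvPolynomial (Fin (n + 1)) k) :
    aeval v f = (finSuccEquiv k n f).eval₂
      (aeval (R := k) fun i : Fin n => v i.succ : MvPolynomial (Fin n) k →+* A) (v 0) := by
  induction f using MvPolynomial.induction_on with
  | C a => simp [finSuccEquiv_apply]
  | add f g hf hg => simp only [map_add, Polynomial.eval₂_add, hf, hg]
  | mul_X f i hf =>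
    rw [map_mul, map_mul, Polynomial.eval₂_mul, hf, aeval_X]
    congr 1
    cases i using Fin.cases <;> simp [finSuccEquiv_X_zero, finSuccEquiv_X_succ]

/-- If a polynomial in a weakly regular sequence `v` on `M` kills `m`, then so do its coefficients,
as long as scalars taking `m` into `(v) M` kill `m`. -/
theorem algebraMap_coeff_smul_eq_zero_of_isWeaklyRegular {k A : Type*} [CommRing k] [CommRing A]
    [Algebra k A] {n : ℕ} {v : Fin n → A} {M : Type*} [AddCommGroup M] [Module A M] {m : M}
    (hv : IsWeaklyRegular M (List.ofFn v))
    (hm : ∀ c : k, algebraMap k A c • m ∈ Ideal.ofList (List.ofFn v) • (⊤ : Submodule A M) →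
      algebraMap k A c • m = 0)
    {f : MvPolynomial (Fin n) k} (hf : aeval v f • m = 0) (d : Fin n →₀ ℕ) :
    algebraMap k A (coeff d f) • m = 0 := by
  induction n generalizing M with
  | zero =>
    obtain ⟨c, rfl⟩ := C_surjective (Fin 0) f
    rw [Subsingleton.elim d 0, coeff_zero_C]
    simpa using hf
  | succ n ih =>
    rw [List.ofFn_succ] at hv hm
    rw [isWeaklyRegular_cons_iff] at hv
    obtain ⟨hreg, hv⟩ := hv
    rw [Ideal.ofList_cons_smul] at hm
    have coeff_smul : ∀ (i : ℕ) (q : Polynomial (MvPolynomial (Fin n) k)),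
        q.eval₂ (aeval (R := k) fun i : Fin n => v i.succ : MvPolynomial (Fin n) k →+* A) (v 0) • m
          = 0 → ∀ e, algebraMap k A (coeff e (q.coeff i)) • m = 0 := by
      have coeff_zero_smul : ∀ (q : Polynomial (MvPolynomial (Fin n) k)),
          q.eval₂ (aeval (R := k) fun i : Fin n => v i.succ : MvPolynomial (Fin n) k →+* A)
            (v 0) • m = 0 → ∀ e, algebraMap k A (coeff e (q.coeff 0)) • m = 0 := by
        intro q hq e
        refine hm _ (Submodule.mem_sup_left ?_)
        rw [← Submodule.Quotient.mk_eq_zero, Submodule.Quotient.mk_smul]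
        refine ih (M := QuotSMulTop (v 0) M) hv (fun c hc => ?_) ?_ e
        · rw [← Submodule.Quotient.mk_smul] at hc ⊢
          rw [hm c, Submodule.Quotient.mk_zero]
          rwa [← Submodule.range_mkQ, ← Submodule.map_top, ← Submodule.map_smul'',
            ← Submodule.mkQ_apply, ← Submodule.mem_comap, Submodule.comap_map_mkQ] at hc
        · rw [← Submodule.Quotient.mk_smul, Submodule.Quotient.mk_eq_zero]
          rw [← q.divX_mul_X_add, Polynomial.eval₂_add, Polynomial.eval₂_mul, Polynomial.eval₂_X,
            Polynomial.eval₂_C, add_smul, mul_comm, mul_smul] at hq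
          rw [RingHom.coe_coe] at hq
          rw [eq_neg_of_add_eq_zero_right hq]
          exact neg_mem (Submodule.smul_mem_pointwise_smul _ _ _ trivial)
      intro i
      induction i with
      | zero => exact coeff_zero_smul
      | succ i ihi =>
        intro q hq e
        rw [← Polynomial.coeff_divX]
        refine ihi _ (hreg.right_eq_zero_of_smul ?_) e
        have hzero : aeval (fun i : Fin n => v i.succ) (q.coeff 0) • m = 0 := by
          rw [aeval_def, eval₂_eq, Finset.sum_smul]
          refine Finset.sum_eq_zero fun e _ => ?_
          rw [mul_comm, mul_smul, coeff_zero_smul q hq e, smul_zero]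
        rw [← q.divX_mul_X_add, Polynomial.eval₂_add, Polynomial.eval₂_mul, Polynomial.eval₂_X,
          Polynomial.eval₂_C, add_smul, mul_comm, mul_smul, RingHom.coe_coe, hzero, add_zero] at hq
        exact hq
    have := coeff_smul (d 0) (finSuccEquiv k n f) (by rwa [← aeval_eq_eval₂_finSuccEquiv]) d.tail
    rwa [finSuccEquiv_coeff_coeff, Finsupp.cons_tail] at this

/-- Graded Nakayama: homogeneous elements of positive degree which generate `A` modulo an element
of the Jacobson radical of the base ring generate `A`. -/
theorem aeval_surjective_of_graded {R A ι : Type*} [CommRing R] [CommRing A] [Algebra R A]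
    (𝒜 : ℕ → Submodule R A) [GradedAlgebra 𝒜] (hfg : ∀ d, (𝒜 d).FG) {v : ι → A} {e : ι → ℕ}
    (hv : ∀ i, v i ∈ 𝒜 (e i)) (he : ∀ i, 0 < e i) {ϖ : R}
    (hϖ : ϖ ∈ Ideal.jacobson (⊥ : Ideal R))
    (hgen : ∀ a : A, ∃ r : R,
      a - algebraMap R A r ∈ Ideal.span ({algebraMap R A ϖ} ∪ Set.range v)) :
    Function.Surjective (aeval (R := R) v) := by
  have hle : ∀ d, 𝒜 d ≤ Subalgebra.toSubmodule (aeval (R := R) v).range := by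
    intro d
    induction d using Nat.strong_induction_on with
    | _ d ih =>
      refine Submodule.le_of_le_smul_of_le_jacobson_bot (I := Ideal.span {ϖ}) (hfg d)
        ((Ideal.span_singleton_le_iff_mem _).2 hϖ) fun a ha => ?_
      set T := Subalgebra.toSubmodule (aeval (R := R) v).range ⊔ Ideal.span {ϖ} • 𝒜 d
      have hspan : ∀ x ∈ Ideal.span ({algebraMap R A ϖ} ∪ Set.range v),
          ∀ b : A, (DirectSum.decompose 𝒜 (b * x) d : A) ∈ T := by
        intro x hx
        induction hx using Submodule.span_induction with
        | mem x hx =>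
          intro b
          rcases hx with rfl | ⟨i, rfl⟩
          · rw [mul_comm, ← Algebra.smul_def, DirectSum.decompose_smul]
            exact Submodule.mem_sup_right (Submodule.smul_mem_smul
              (Ideal.mem_span_singleton_self ϖ) (SetLike.coe_mem _))
          · rw [mul_comm]
            by_cases hid : e i ≤ d
            · rw [DirectSum.coe_decompose_mul_of_left_mem_of_le 𝒜 (hv i) hid]
              have hrange := ih (d - e i) (by have := he i; omega)
                (SetLike.coe_mem (DirectSum.decompose 𝒜 b (d - e i)))
              exact Submodule.mem_sup_left (Subalgebra.mul_mem _ ⟨X i, aeval_X _ _⟩ hrange)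
            · rw [DirectSum.coe_decompose_mul_of_left_mem_of_not_le 𝒜 (hv i) hid]
              exact zero_mem _
        | zero => simp
        | add x y _ _ hx hy =>
          intro b
          rw [mul_add, DirectSum.decompose_add]
          exact add_mem (hx b) (hy b)
        | smul c x _ hx =>
          intro b
          rw [smul_eq_mul, ← mul_assoc]
          exact hx _
      obtain ⟨r, hr⟩ := hgen a
      have hmem := hspan _ hr 1
      rw [one_mul, DirectSum.decompose_sub, DirectSum.sub_apply, Submodule.coe_sub,
        DirectSum.decompose_of_mem_same 𝒜 ha] at hmem
      rw [← sub_add_cancel a (DirectSum.decompose 𝒜 (algebraMap R A r) d : A)]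
      refine add_mem hmem (Submodule.mem_sup_left ?_)
      have hr0 : algebraMap R A r ∈ 𝒜 0 := SetLike.algebraMap_mem_graded 𝒜 r
      by_cases hd : d = 0
      · subst hd
        rw [DirectSum.decompose_of_mem_same 𝒜 hr0]
        exact Subalgebra.algebraMap_mem _ r
      · rw [DirectSum.decompose_of_mem_ne 𝒜 hr0 (Ne.symm hd)]
        exact zero_mem _
  intro a
  classical
  rw [← DirectSum.sum_support_decompose 𝒜 a]
  exact (Subalgebra.sum_mem _ fun d _ => hle d (SetLike.coe_mem _) :
    _ ∈ (aeval (R := R) v).range)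

/-- Over a Noetherian local ring with principal maximal ideal `(ϖ)`, a sequence `v` such that
`ϖ, v` is regular is algebraically independent. -/
theorem aeval_injective_of_isRegular {R A : Type*} [CommRing R] [IsLocalRing R]
    [IsNoetherianRing R] [CommRing A] [Algebra R A] {ϖ : R}
    (hϖ : IsLocalRing.maximalIdeal R = Ideal.span {ϖ}) {n : ℕ} {v : Fin n → A}
    (hreg : IsRegular A (algebraMap R A ϖ :: List.ofFn v)) :
    Function.Injective (aeval (R := R) v) := by
  obtain ⟨hϖreg, hv⟩ := (isRegular_cons_iff A _ _).1 hreg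
  have hdvd : ∀ f : MvPolynomial (Fin n) R, aeval v f = 0 → C ϖ ∣ f := by
    intro f hf
    rw [C_dvd_iff_dvd_coeff]
    intro d
    have hϖ_smul : ∀ c ∈ IsLocalRing.maximalIdeal R, algebraMap R A c •
        (Submodule.Quotient.mk 1 : QuotSMulTop (algebraMap R A ϖ) A) = 0 := by
      intro c hc
      rw [hϖ, Ideal.mem_span_singleton] at hc
      obtain ⟨b, rfl⟩ := hc
      rw [← Submodule.Quotient.mk_smul, Submodule.Quotient.mk_eq_zero, map_mul, mul_smul]
      exact Submodule.smul_mem_pointwise_smul _ _ _ trivial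
    have hunit : ∀ c : R, algebraMap R A c •
        (Submodule.Quotient.mk 1 : QuotSMulTop (algebraMap R A ϖ) A) ∈
          Ideal.ofList (List.ofFn v) • (⊤ : Submodule A (QuotSMulTop (algebraMap R A ϖ) A)) →
        c ∈ IsLocalRing.maximalIdeal R := by
      intro c hc hcu
      refine hv.top_ne_smul (top_le_iff.1 fun x _ => ?_).symm
      obtain ⟨a, rfl⟩ := Submodule.Quotient.mk_surjective _ x
      rw [Submodule.smul_mem_iff_of_isUnit _ (hcu.map (algebraMap R A))] at hc
      have ha := Submodule.smul_mem _ a hc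
      rwa [← Submodule.Quotient.mk_smul, smul_eq_mul, mul_one] at ha
    have hcoeff := algebraMap_coeff_smul_eq_zero_of_isWeaklyRegular
      (m := (Submodule.Quotient.mk 1 : QuotSMulTop (algebraMap R A ϖ) A)) hv.toIsWeaklyRegular
      (fun c hc => hϖ_smul c (hunit c hc)) (f := f)
      (by rw [hf, zero_smul]) d
    rw [← Ideal.mem_span_singleton, ← hϖ]
    exact hunit _ (hcoeff ▸ zero_mem _)
  have hpow : ∀ (j : ℕ) (f : MvPolynomial (Fin n) R), aeval v f = 0 →
      ∀ d, coeff d f ∈ IsLocalRing.maximalIdeal R ^ j := by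
    intro j
    induction j with
    | zero => simp
    | succ j ih =>
      intro f hf d
      obtain ⟨g, rfl⟩ := hdvd f hf
      rw [map_mul, aeval_C] at hf
      rw [coeff_C_mul, pow_succ']
      exact Ideal.mul_mem_mul (hϖ ▸ Ideal.mem_span_singleton_self ϖ)
        (ih g (hϖreg.right_eq_zero_of_smul hf) d)
  rw [injective_iff_map_eq_zero]
  intro f hf
  ext d
  rw [coeff_zero, ← Ideal.mem_bot, ← Ideal.iInf_pow_eq_bot_of_isLocalRing
    (IsLocalRing.maximalIdeal R) Ideal.IsPrime.ne_top', Ideal.mem_iInf]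
  exact fun j => hpow j f hf d

end MvPolynomial

/-- Let `p` be prime, `R = ℤ_(p)`, and `A` a commutative
`R`-algebra with grading `𝒜 : ℕ → Submodule R A`, each `𝒜 d` finite free over
`R`, together with homogeneous `v i ∈ 𝒜 (2(p^(i+1) − 1))` for `i : Fin n`, such
that `(p, v 0, …, v (n-1))` is a regular sequence on `A`, the quotient
`A/(p, v …)` is isomorphic to `𝔽_p`, and all positive-degree components lie in
the ideal `(p, v …)` ("the quotient is concentrated in degree 0"). Then the
`R`-algebra map `R[x₁,…,xₙ] → A`, `xᵢ ↦ vᵢ`, is an isomorphism. -/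
theorem graded_polynomial_generation
    (p : ℕ) (hp : p.Prime) [hP : (Ideal.span {(p : ℤ)}).IsPrime]
    {A : Type*} [CommRing A]
    [Algebra (Localization.AtPrime (Ideal.span {(p : ℤ)})) A]
    (𝒜 : ℕ → Submodule (Localization.AtPrime (Ideal.span {(p : ℤ)})) A)
    [GradedAlgebra 𝒜]
    (hfree : ∀ d, Module.Finite (Localization.AtPrime (Ideal.span {(p : ℤ)})) (𝒜 d) ∧
      Module.Free (Localization.AtPrime (Ideal.span {(p : ℤ)})) (𝒜 d))
    (n : ℕ) (v : Fin n → A)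
    (hdeg : ∀ i : Fin n, v i ∈ 𝒜 (2 * (p ^ ((i : ℕ) + 1) - 1)))
    (hreg : RingTheory.Sequence.IsRegular A ((p : A) :: List.ofFn v))
    (hquot : Nonempty
      ((A ⧸ Ideal.span ({(p : A)} ∪ Set.range v)) ≃+* ZMod p))
    (hconc : ∀ d : ℕ, 0 < d → ∀ a ∈ 𝒜 d, a ∈ Ideal.span ({(p : A)} ∪ Set.range v)) :
    Function.Bijective
      (MvPolynomial.aeval (R := Localization.AtPrime (Ideal.span {(p : ℤ)})) v) := by
  have hmax : IsLocalRing.maximalIdeal (Localization.AtPrime (Ideal.span {(p : ℤ)})) =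
      Ideal.span {(p : Localization.AtPrime (Ideal.span {(p : ℤ)}))} := by
    rw [← Localization.AtPrime.map_eq_maximalIdeal, Ideal.map_span, Set.image_singleton,
      map_natCast]
  have hnoeth : IsNoetherianRing (Localization.AtPrime (Ideal.span {(p : ℤ)})) :=
    IsLocalization.isNoetherianRing (Ideal.span {(p : ℤ)}).primeCompl _ inferInstance
  rw [← map_natCast (algebraMap (Localization.AtPrime (Ideal.span {(p : ℤ)})) A) p]
    at hreg hquot
  refine ⟨MvPolynomial.aeval_injective_of_isRegular hmax hreg,
    MvPolynomial.aeval_surjective_of_graded 𝒜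
      (fun d => (Module.Finite.iff_fg (N := 𝒜 d)).1 (hfree d).1) hdeg (fun i => ?_)
      (ϖ := (p : Localization.AtPrime (Ideal.span {(p : ℤ)}))) ?_ fun a => ?_⟩
  · have := Nat.one_lt_pow (Nat.succ_ne_zero (i : ℕ)) hp.one_lt
    simp only [Nat.succ_eq_add_one] at this
    omega
  · rw [IsLocalRing.jacobson_eq_maximalIdeal _ bot_ne_top, hmax]
    exact Ideal.mem_span_singleton_self _
  · obtain ⟨φ⟩ := hquot
    obtain ⟨k, hk⟩ := ZMod.intCast_surjective (φ (Ideal.Quotient.mk _ a))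
    refine ⟨(k : Localization.AtPrime (Ideal.span {(p : ℤ)})), ?_⟩
    rw [← Ideal.Quotient.eq]
    apply φ.injective
    rw [← hk, map_intCast, map_intCast, map_intCast]
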